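/- If y, z ∈ ℝ^n (n ≥ 3) are linearly independent, then the matrix Q = 2((‖y‖²‖z‖² − ⟨y,z⟩²)I_n + (yzᵀ − zyᵀ)²) has rank exactly n − 2, with kernel equal to span{y, z}. -/

import Mathlib

open Matrix

noncomputable def Qmat {n : ℕ} (y z : Fin n → ℝ) : Matrix (Fin n) (Fin n) ℝ :=
  (2 : ℝ) • ((((y ⬝ᵥ y) * (z ⬝ᵥ z) - (y ⬝ᵥ z) ^ 2) • (1 : Matrix (Fin n) (Fin n) ℝ))
    + (Matrix.vecMulVec y z - Matrix.vecMulVec z y) ^ 2)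

theorem gram_ne_zero {n : ℕ} (y z : Fin n → ℝ) (h : LinearIndependent ℝ ![y, z]) :
    (y ⬝ᵥ y) * (z ⬝ᵥ z) - (y ⬝ᵥ z) ^ 2 ≠ 0 := by
  intro hD
  have hp := LinearIndependent.pair_iff.mp h
  have h1 : (z ⬝ᵥ z) • y + (-(y ⬝ᵥ z)) • z = 0 := by
    apply dotProduct_self_eq_zero.mp
    simp only [add_dotProduct, dotProduct_add, smul_dotProduct, dotProduct_smul, smul_eq_mul,
      dotProduct_comm z y]
    linear_combination (z ⬝ᵥ z) * hD
  have hz : z = 0 := dotProduct_self_eq_zero.mp (hp _ _ h1).1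
  have := hp 0 1 (by simp [hz])
  simp at this

theorem Qmat_mulVec {n : ℕ} (y z v : Fin n → ℝ) :
    Qmat y z *ᵥ v = (2 : ℝ) • (((y ⬝ᵥ y) * (z ⬝ᵥ z) - (y ⬝ᵥ z) ^ 2) • v
      + (((z ⬝ᵥ v) * (y ⬝ᵥ z) - (y ⬝ᵥ v) * (z ⬝ᵥ z)) • y
        - ((z ⬝ᵥ v) * (y ⬝ᵥ y) - (y ⬝ᵥ v) * (y ⬝ᵥ z)) • z)) := by
  have hM : ∀ w : Fin n → ℝ, (Matrix.vecMulVec y z - Matrix.vecMulVec z y) *ᵥ w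
      = (z ⬝ᵥ w) • y - (y ⬝ᵥ w) • z := by
    intro w
    simp [Matrix.sub_mulVec, Matrix.vecMulVec_mulVec]
  rw [Qmat, Matrix.smul_mulVec, Matrix.add_mulVec, Matrix.smul_mulVec, Matrix.one_mulVec,
    pow_two (Matrix.vecMulVec y z - Matrix.vecMulVec z y),
    ← Matrix.mulVec_mulVec, hM, hM]
  simp only [dotProduct_sub, dotProduct_smul, smul_eq_mul, dotProduct_comm z y]

theorem Qmat_ker {n : ℕ} (y z : Fin n → ℝ) (h : LinearIndependent ℝ ![y, z]) (v : Fin n → ℝ) :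
    Qmat y z *ᵥ v = 0 ↔ v ∈ Submodule.span ℝ {y, z} := by
  have hD := gram_ne_zero y z h
  rw [Qmat_mulVec, Submodule.mem_span_pair]
  constructor
  · intro hv
    have hv := (smul_eq_zero.mp hv).resolve_left two_ne_zero
    set D := (y ⬝ᵥ y) * (z ⬝ᵥ z) - (y ⬝ᵥ z) ^ 2 with hDdef
    set p := (z ⬝ᵥ v) * (y ⬝ᵥ z) - (y ⬝ᵥ v) * (z ⬝ᵥ z)
    set q := (z ⬝ᵥ v) * (y ⬝ᵥ y) - (y ⬝ᵥ v) * (y ⬝ᵥ z)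
    refine ⟨-p / D, q / D, ?_⟩
    ext i
    have hi := congrFun hv i
    simp only [Pi.add_apply, Pi.sub_apply, Pi.smul_apply, smul_eq_mul, Pi.zero_apply] at hi ⊢
    field_simp
    linear_combination -hi
  · rintro ⟨a, b, rfl⟩
    ext i
    simp only [dotProduct_add, dotProduct_smul, smul_eq_mul, dotProduct_comm z y,
      Pi.add_apply, Pi.sub_apply, Pi.smul_apply, Pi.zero_apply]
    ring

theorem Qmat_rank_and_kernel {n : ℕ} (hn : 3 ≤ n) (y z : Fin n → ℝ)
    (h : LinearIndependent ℝ ![y, z]) :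
    (Qmat y z).rank = n - 2 ∧
      (∀ v : Fin n → ℝ, Qmat y z *ᵥ v = 0 ↔ v ∈ Submodule.span ℝ {y, z}) := by
  refine ⟨?_, Qmat_ker y z h⟩
  have hk : LinearMap.ker (Qmat y z).mulVecLin = Submodule.span ℝ (Set.range ![y, z]) := by
    ext v
    rw [LinearMap.mem_ker, Matrix.mulVecLin_apply, Qmat_ker y z h]
    simp [Set.pair_comm]
  have hr := LinearMap.finrank_range_add_finrank_ker (Qmat y z).mulVecLin
  rw [hk, finrank_span_eq_card h] at hr
  simp only [Fintype.card_fin, Module.finrank_fin_fun] at hr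
  rw [Matrix.rank]
  omega
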